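/- Let s ≥ 7, let η ∈ ℋ^{s+4} satisfy condition (H), let g solve the filtered Vlasov-HMF equation with Q_{0,s}(g) ≤ R₀ and ε small enough so that the scattering limit g^∞ ∈ ℋ^{s−4} exists with ‖g(t) − g^∞‖_{ℋ^r} ≤ C/⟨t⟩^{s−r−3} for 1 ≤ r ≤ s−4. Define η^∞(v) = η(v) + (ε/2π) ∫_𝕋 g^∞(x,v) dx and f(t,x,v) = η(v) + ε g(t,x−tv,v). Then for every integer r with 1 ≤ r ≤ s−4 there is a constant C such that for all ξ ∈ ℝ and t ≥ 0: |f̂_0(t,ξ) − η̂^∞_0(ξ)| ≤ C / (⟨ξ⟩^r ⟨t⟩^{s−r−3}). In particular f(t,·,·) converges weakly to the spatially homogeneous state η^∞(v). -/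

import Mathlib

open MeasureTheory Real Set

noncomputable section

/-- The measure on `𝕋 × ℝ`, with `𝕋 = ℝ/2πℤ` modeled as `(0, 2π] × ℝ ⊆ ℝ × ℝ`. -/
def μTR : Measure (ℝ × ℝ) := (volume.restrict (Set.Ioc 0 (2 * π))).prod volume

/-- Partial derivative in the first (space) variable. -/
def pX (f : ℝ → ℝ → ℂ) : ℝ → ℝ → ℂ := fun x v => deriv (fun x' => f x' v) x

/-- Partial derivative in the second (velocity) variable. -/
def pV (f : ℝ → ℝ → ℂ) : ℝ → ℝ → ℂ := fun x v => deriv (fun v' => f x v') v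

/-- The weighted integrand `(1+v²)^{m₀} |∂ₓᵖ ∂ᵥ^q f|²`. -/
def wInt (m0 : ℝ) (p q : ℕ) (f : ℝ → ℝ → ℂ) : ℝ × ℝ → ℝ :=
  fun z => (1 + z.2 ^ 2) ^ m0 * ‖(pX^[p] (pV^[q] f)) z.1 z.2‖ ^ 2

/-- Square of the weighted Sobolev norm: `‖f‖_{ℋⁿ}² = ∑_{p+q ≤ n} ∫ (1+v²)^{m₀}|∂ₓᵖ∂ᵥ^q f|²`. -/
def HnormSq (m0 : ℝ) (n : ℕ) (f : ℝ → ℝ → ℂ) : ℝ :=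
  ∑ p ∈ Finset.range (n + 1), ∑ q ∈ Finset.range (n + 1 - p), ∫ z, wInt m0 p q f z ∂μTR

/-- The weighted Sobolev norm `‖f‖_{ℋⁿ}`. -/
def Hnorm (m0 : ℝ) (n : ℕ) (f : ℝ → ℝ → ℂ) : ℝ := Real.sqrt (HnormSq m0 n f)

/-- Membership in the weighted Sobolev space `ℋⁿ` on `𝕋 × ℝ`. -/
def MemH (m0 : ℝ) (n : ℕ) (f : ℝ → ℝ → ℂ) : Prop :=
  ContDiff ℝ n (Function.uncurry f) ∧
  (∀ v, Function.Periodic (fun x => f x v) (2 * π)) ∧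
  ∀ p q : ℕ, p + q ≤ n → Integrable (wInt m0 p q f) μTR

/-- The Fourier coefficient `f̂ₖ(ξ) = (1/2π) ∫_{𝕋×ℝ} f(x,v) e^{-ikx-iξv} dx dv`. -/
def fHat (f : ℝ → ℝ → ℂ) (k : ℤ) (ξ : ℝ) : ℂ :=
  (1 / (2 * π)) * ∫ z, f z.1 z.2 * Complex.exp (-Complex.I * ((k : ℝ) * z.1 + ξ * z.2)) ∂μTR

/-- The Japanese bracket `⟨t⟩ = (1+t²)^{1/2}`. -/
def jap (t : ℝ) : ℝ := Real.sqrt (1 + t ^ 2)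

/-- The Fourier transform `η̂₀(ξ)` of a spatially homogeneous state `η = η(v)`. -/
def etaHat (η : ℝ → ℂ) (ξ : ℝ) : ℂ := fHat (fun _ v => η v) 0 ξ

/-- Fourier coefficients of the HMF kernel `P(x) = cos x`: `p_{±1} = 1/2`, `pₙ = 0` otherwise. -/
def pcoef (n : ℤ) : ℂ := if n = 1 ∨ n = -1 then 1 / 2 else 0

/-- The kernel `K(n,t) = -n pₙ · nt · η̂₀(nt) 1_{t ≥ 0}`. -/
def Kker (η : ℝ → ℂ) (n : ℤ) (t : ℝ) : ℂ :=
  if 0 ≤ t then -(n : ℂ) * pcoef n * ((n : ℂ) * t) * etaHat η ((n : ℝ) * t) else 0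

/-- The Fourier transform `K̂(n,τ) = ∫_ℝ e^{-iτt} K(n,t) dt`, for complex `τ`. -/
def KhatC (η : ℝ → ℂ) (n : ℤ) (τ : ℂ) : ℂ :=
  ∫ t : ℝ, Complex.exp (-Complex.I * τ * (t : ℂ)) * Kker η n t

/-- The Penrose stability condition (H). -/
def Penrose (m0 : ℝ) (η : ℝ → ℂ) : Prop :=
  MemH m0 5 (fun _ v => (1 + (v : ℂ) ^ 2) * η v) ∧
  ∃ κ > 0, ∀ n : ℤ, n = 1 ∨ n = -1 → ∀ τ : ℂ, τ.im ≤ 0 → κ ≤ ‖1 - KhatC η n τ‖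

/-- The Poisson bracket `{f,h} = ∂ₓf ∂ᵥh - ∂ᵥf ∂ₓh`. -/
def pbracket (f h : ℝ → ℝ → ℂ) : ℝ → ℝ → ℂ :=
  fun x v => pX f x v * pV h x v - pV f x v * pX h x v

/-- The filtered HMF mean-field potential `φ(t,g)(x,v) = ∫ cos(x-y+t(v-u)) g(t,y,u) dy du`. -/
def phiHMF (g : ℝ → ℝ → ℝ → ℂ) (t : ℝ) : ℝ → ℝ → ℂ :=
  fun x v => ∫ z, (Real.cos (x - z.1 + t * (v - z.2)) : ℂ) * g t z.1 z.2 ∂μTR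

/-- `g` solves the filtered Vlasov-HMF equation `∂ₜg = {φ(t,g), η} + ε{φ(t,g), g}`. -/
def IsVHMF (ε : ℝ) (η : ℝ → ℂ) (g : ℝ → ℝ → ℝ → ℂ) : Prop :=
  ∀ t x v, HasDerivAt (fun τ => g τ x v)
    (pbracket (phiHMF g t) (fun _ w => η w) x v + ε * pbracket (phiHMF g t) (g t) x v) t

/-- Global smoothness (in all variables) of `g = g(t,x,v)`. -/
def SmoothG (g : ℝ → ℝ → ℝ → ℂ) : Prop :=
  ∀ n : ℕ, ContDiff ℝ n fun p : ℝ × ℝ × ℝ => g p.1 p.2.1 p.2.2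

/-- `ζₖ(t) = ĝₖ(t, kt)`. -/
def zeta (g : ℝ → ℝ → ℝ → ℂ) (k : ℤ) (t : ℝ) : ℂ := fHat (g t) k ((k : ℝ) * t)

/-- The bound `Q_{T,s}(g) ≤ R`, where
`Q_{T,s}(g) = sup_{[0,T]} ‖g(t)‖_{ℋˢ}/⟨t⟩³ + sup_{[0,T]} max_{k=±1} ⟨t⟩^{s-1}|ζₖ(t)| + sup_{[0,T]} ‖g(t)‖_{ℋ^{s-4}}`. -/
def Qle (m0 : ℝ) (s : ℕ) (g : ℝ → ℝ → ℝ → ℂ) (T R : ℝ) : Prop :=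
  ∃ A B C : ℝ, A + B + C ≤ R ∧
    (∀ t ∈ Set.Icc (0 : ℝ) T, Hnorm m0 s (g t) / jap t ^ 3 ≤ A) ∧
    (∀ t ∈ Set.Icc (0 : ℝ) T, ∀ k : ℤ, k = 1 ∨ k = -1 → jap t ^ (s - 1) * ‖zeta g k t‖ ≤ B) ∧
    (∀ t ∈ Set.Icc (0 : ℝ) T, Hnorm m0 (s - 4) (g t) ≤ C)

lemma fHat_zero (f : ℝ → ℝ → ℂ) (ξ : ℝ) :
    fHat f 0 ξ =
      (1 / (2 * π)) * ∫ z, f z.1 z.2 * Complex.exp (-Complex.I * (ξ * z.2)) ∂μTR := by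
  simp [fHat]

lemma norm_exp_neg_I_mul (ξ v : ℝ) : ‖Complex.exp (-Complex.I * (ξ * v))‖ = 1 := by
  rw [show -Complex.I * ((ξ : ℂ) * v) = ((-(ξ * v) : ℝ) : ℂ) * Complex.I by push_cast; ring]
  exact Complex.norm_exp_ofReal_mul_I _

lemma continuous_exp_neg_I_mul (ξ : ℝ) :
    Continuous fun v : ℝ => Complex.exp (-Complex.I * (ξ * v)) := by
  fun_prop

lemma integrable_mul_exp_neg_I {f : ℝ → ℝ → ℂ} (hf : Integrable (Function.uncurry f) μTR)
    (ξ : ℝ) :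
    Integrable (fun z : ℝ × ℝ => f z.1 z.2 * Complex.exp (-Complex.I * (ξ * z.2))) μTR := by
  refine hf.mul_bdd (c := 1) ?_ (.of_forall fun z => (norm_exp_neg_I_mul ξ z.2).le)
  exact ((continuous_exp_neg_I_mul ξ).comp continuous_snd).aestronglyMeasurable

lemma integrable_weight_inv {m0 : ℝ} (hm0 : 1 / 2 < m0) :
    Integrable (fun z : ℝ × ℝ => ((1 + z.2 ^ 2) ^ m0)⁻¹) μTR := by
  have h := integrable_rpow_neg_one_add_norm_sq (E := ℝ) (μ := volume) (r := 2 * m0)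
    (by simp; linarith)
  refine (h.comp_snd (volume.restrict (Ioc 0 (2 * π)))).congr (.of_forall fun z => ?_)
  simp only [norm_eq_abs, sq_abs]
  rw [← Real.rpow_neg (by positivity)]
  congr 1
  ring

lemma norm_le_weighted (a : ℂ) {w N : ℝ} (hw : 0 < w) (hN : 0 < N) :
    ‖a‖ ≤ N * w⁻¹ + N⁻¹ * (w * ‖a‖ ^ 2) := by
  have h : N * w⁻¹ + N⁻¹ * (w * ‖a‖ ^ 2) - ‖a‖ =
      N * w⁻¹ * ((w / N * ‖a‖ - 1 / 2) ^ 2 + 3 / 4) := by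
    field_simp
    ring
  have : 0 ≤ N * w⁻¹ * ((w / N * ‖a‖ - 1 / 2) ^ 2 + 3 / 4) := by positivity
  linarith

lemma integrable_of_weighted {m0 : ℝ} (hm0 : 1 / 2 < m0) {f : ℝ × ℝ → ℂ} (hf : Continuous f)
    (hw : Integrable (fun z => (1 + z.2 ^ 2) ^ m0 * ‖f z‖ ^ 2) μTR) : Integrable f μTR := by
  refine ((integrable_weight_inv hm0).add hw).mono' hf.aestronglyMeasurable
    (.of_forall fun z => ?_)
  simpa using norm_le_weighted (f z) (w := (1 + z.2 ^ 2) ^ m0) (by positivity) one_pos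

lemma integral_norm_le_of_weighted {m0 : ℝ} (hm0 : 1 / 2 < m0) {f : ℝ × ℝ → ℂ}
    (hf : Continuous f) (hw : Integrable (fun z => (1 + z.2 ^ 2) ^ m0 * ‖f z‖ ^ 2) μTR)
    {N : ℝ} (hN : 0 < N) (hle : ∫ z, (1 + z.2 ^ 2) ^ m0 * ‖f z‖ ^ 2 ∂μTR ≤ N ^ 2) :
    ∫ z, ‖f z‖ ∂μTR ≤ ((∫ z : ℝ × ℝ, ((1 + z.2 ^ 2) ^ m0)⁻¹ ∂μTR) + 1) * N := by
  have hi := integrable_weight_inv hm0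
  calc ∫ z, ‖f z‖ ∂μTR
      ≤ ∫ z, (N * ((1 + z.2 ^ 2) ^ m0)⁻¹ + N⁻¹ * ((1 + z.2 ^ 2) ^ m0 * ‖f z‖ ^ 2)) ∂μTR :=
        integral_mono (integrable_of_weighted hm0 hf hw).norm
          ((hi.const_mul N).add (hw.const_mul N⁻¹))
          fun z => norm_le_weighted (f z) (by positivity) hN
    _ = N * (∫ z : ℝ × ℝ, ((1 + z.2 ^ 2) ^ m0)⁻¹ ∂μTR) +
          N⁻¹ * ∫ z, (1 + z.2 ^ 2) ^ m0 * ‖f z‖ ^ 2 ∂μTR := by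
        rw [integral_add (hi.const_mul N) (hw.const_mul N⁻¹), integral_const_mul,
          integral_const_mul]
    _ ≤ N * (∫ z : ℝ × ℝ, ((1 + z.2 ^ 2) ^ m0)⁻¹ ∂μTR) + N⁻¹ * N ^ 2 := by gcongr
    _ = _ := by field_simp

lemma iterate_pV_eq (f : ℝ → ℝ → ℂ) (q : ℕ) (x : ℝ) : pV^[q] f x = iteratedDeriv q (f x) := by
  induction q with
  | zero => simp
  | succ q ih =>
    ext v
    rw [Function.iterate_succ_apply', iteratedDeriv_succ, ← ih]
    rfl

lemma contDiff_pV {f : ℝ → ℝ → ℂ} {n : ℕ} (hf : ContDiff ℝ (n + 1 : ℕ) (Function.uncurry f)) :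
    ContDiff ℝ n (Function.uncurry (pV f)) := by
  have h : Function.uncurry (pV f) =
      fun z => fderiv ℝ (Function.uncurry f) z ((0 : ℝ), (1 : ℝ)) := by
    ext ⟨x, v⟩
    have h1 : HasFDerivAt (Function.uncurry f) (fderiv ℝ (Function.uncurry f) (x, v)) (x, v) :=
      (hf.differentiable (by simp) _).hasFDerivAt
    have h2 : HasDerivAt (fun w : ℝ => (x, w)) ((0 : ℝ), (1 : ℝ)) v :=
      (hasDerivAt_const v x).prodMk (hasDerivAt_id v)
    exact (h1.comp_hasDerivAt v h2).deriv
  rw [h]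
  exact (hf.fderiv_right (by norm_cast)).clm_apply contDiff_const

lemma contDiff_iterate_pV {f : ℝ → ℝ → ℂ} {q n : ℕ}
    (hf : ContDiff ℝ (n + q : ℕ) (Function.uncurry f)) :
    ContDiff ℝ n (Function.uncurry (pV^[q] f)) := by
  induction q generalizing n with
  | zero => simpa using hf
  | succ q ih =>
    rw [Function.iterate_succ_apply']
    refine contDiff_pV (ih ?_)
    rwa [show n + 1 + q = n + (q + 1) by ring]

lemma continuous_iterate_pV {f : ℝ → ℝ → ℂ} {q n : ℕ} (hqn : q ≤ n)
    (hf : ContDiff ℝ n (Function.uncurry f)) : Continuous (Function.uncurry (pV^[q] f)) := by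
  have : ContDiff ℝ (0 + q : ℕ) (Function.uncurry f) := hf.of_le (by simpa using hqn)
  exact (contDiff_iterate_pV this).continuous

lemma contDiff_slice {f : ℝ → ℝ → ℂ} {n : ℕ} (hf : ContDiff ℝ n (Function.uncurry f)) (x : ℝ) :
    ContDiff ℝ n (f x) :=
  hf.comp (contDiff_const.prodMk contDiff_id : ContDiff ℝ n fun v : ℝ => (x, v))

lemma iterate_pV_sub {f h : ℝ → ℝ → ℂ} {n q : ℕ} (hqn : q ≤ n)
    (hf : ContDiff ℝ n (Function.uncurry f)) (hh : ContDiff ℝ n (Function.uncurry h)) (x v : ℝ) :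
    (pV^[q] fun x v => f x v - h x v) x v = (pV^[q] f) x v - (pV^[q] h) x v := by
  have hq : (q : WithTop ℕ∞) ≤ n := by exact_mod_cast hqn
  simp only [iterate_pV_eq]
  exact iteratedDeriv_fun_sub ((contDiff_slice hf x).of_le hq).contDiffAt
    ((contDiff_slice hh x).of_le hq).contDiffAt

lemma integral_iterate_pV_mul_exp {f : ℝ → ℝ → ℂ} {n : ℕ}
    (hf : ContDiff ℝ n (Function.uncurry f))
    (hi : ∀ q ≤ n, Integrable (Function.uncurry (pV^[q] f)) μTR) (ξ : ℝ) :
    ∫ z, (pV^[n] f) z.1 z.2 * Complex.exp (-Complex.I * (ξ * z.2)) ∂μTR =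
      (Complex.I * ξ) ^ n *
        ∫ z, f z.1 z.2 * Complex.exp (-Complex.I * (ξ * z.2)) ∂μTR := by
  have key : ∀ᵐ x ∂(volume.restrict (Ioc 0 (2 * π))),
      ∫ v, (pV^[n] f) x v * Complex.exp (-Complex.I * (ξ * v)) =
        (Complex.I * ξ) ^ n * ∫ v, f x v * Complex.exp (-Complex.I * (ξ * v)) := by
    have hae : ∀ᵐ x ∂(volume.restrict (Ioc 0 (2 * π))),
        ∀ q, q ≤ n → Integrable ((pV^[q] f) x) := by
      refine ae_all_iff.2 fun q => ?_
      by_cases hq : q ≤ n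
      · filter_upwards [(hi q hq).prod_right_ae] with x hx _ using hx
      · exact .of_forall fun x h => absurd h hq
    filter_upwards [hae] with x hx
    have h := congrFun (Real.fourier_iteratedDeriv (f := f x) (N := (n : ℕ∞)) (n := n)
      (by exact_mod_cast contDiff_slice hf x)
      (fun q hq => by rw [← iterate_pV_eq]; exact hx q (by exact_mod_cast hq)) le_rfl)
      (ξ / (2 * π))
    rw [Real.fourier_real_eq_integral_exp_smul, Real.fourier_real_eq_integral_exp_smul] at h
    have hpi : (π : ℂ) ≠ 0 := by exact_mod_cast pi_ne_zero
    have e1 : ∀ v : ℝ, Complex.exp (↑(-2 * π * v * (ξ / (2 * π))) * Complex.I) =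
        Complex.exp (-Complex.I * (ξ * v)) := fun v => by
      congr 1
      push_cast
      field_simp
    have e2 : 2 * (π : ℂ) * Complex.I * ((ξ / (2 * π) : ℝ) : ℂ) = Complex.I * ξ := by
      push_cast
      field_simp
    simp only [e1, e2, smul_eq_mul] at h
    simpa only [iterate_pV_eq, mul_comm (Complex.exp _)] using h
  have hn := integrable_mul_exp_neg_I (hi n le_rfl) ξ
  have h0 := integrable_mul_exp_neg_I (f := f) (hi 0 n.zero_le) ξ
  unfold μTR at hn h0 ⊢
  rw [integral_prod _ hn, integral_prod _ h0, ← integral_const_mul]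
  exact integral_congr_ae key

lemma integral_periodic_shift {E : Type*} [NormedAddCommGroup E] [NormedSpace ℝ E] {f : ℝ → E}
    (hf : Function.Periodic f (2 * π)) (a : ℝ) :
    ∫ x in Ioc 0 (2 * π), f (x - a) = ∫ x in Ioc 0 (2 * π), f x := by
  rw [← intervalIntegral.integral_of_le two_pi_pos.le,
    ← intervalIntegral.integral_of_le two_pi_pos.le, intervalIntegral.integral_comp_sub_right]
  have h := hf.intervalIntegral_add_eq (0 - a) 0
  rwa [zero_add, show 0 - a + 2 * π = 2 * π - a by ring] at h

lemma integrable_free_transport {f : ℝ → ℝ → ℂ} (hc : Continuous (Function.uncurry f))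
    (hp : ∀ v, Function.Periodic (fun x => f x v) (2 * π))
    (hi : Integrable (Function.uncurry f) μTR) (t : ℝ) :
    Integrable (fun z : ℝ × ℝ => f (z.1 - t * z.2) z.2) μTR := by
  have hc' : Continuous fun z : ℝ × ℝ => f (z.1 - t * z.2) z.2 :=
    hc.comp (f := fun z : ℝ × ℝ => (z.1 - t * z.2, z.2)) (by fun_prop)
  unfold μTR at hi ⊢
  rw [integrable_prod_iff' hc'.aestronglyMeasurable]
  constructor
  · refine .of_forall fun v => ?_
    have : Continuous fun x : ℝ => f (x - t * v) v :=
      hc'.comp (f := fun x : ℝ => (x, v)) (by fun_prop)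
    exact this.integrableOn_Ioc
  · refine hi.norm.integral_prod_right.congr (.of_forall fun v => ?_)
    exact (integral_periodic_shift ((hp v).comp norm) (t * v)).symm

lemma fHat_zero_free_transport {f : ℝ → ℝ → ℂ} (hc : Continuous (Function.uncurry f))
    (hp : ∀ v, Function.Periodic (fun x => f x v) (2 * π))
    (hi : Integrable (Function.uncurry f) μTR) (t ξ : ℝ) :
    fHat (fun x v => f (x - t * v) v) 0 ξ = fHat f 0 ξ := by
  rw [fHat_zero, fHat_zero]
  congr 1
  have h1 := integrable_mul_exp_neg_I (f := fun x v => f (x - t * v) v)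
    (integrable_free_transport hc hp hi t) ξ
  have h2 := integrable_mul_exp_neg_I hi ξ
  unfold μTR at h1 h2 ⊢
  rw [integral_prod_symm _ h1, integral_prod_symm _ h2]
  congr 1
  ext v
  simp only [integral_mul_const]
  exact congrArg (· * _) (integral_periodic_shift (hp v) (t * v))

lemma integral_snd_μTR (F : ℝ → ℂ) : ∫ z, F z.2 ∂μTR = 2 * π * ∫ v, F v := by
  unfold μTR
  rw [integral_fun_snd]
  simp [Measure.real, pi_pos.le]

lemma integrable_space_integral {f : ℝ → ℝ → ℂ} (hi : Integrable (Function.uncurry f) μTR) :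
    Integrable (fun z : ℝ × ℝ => ∫ x in (0 : ℝ)..(2 * π), f x z.2) μTR := by
  unfold μTR at hi ⊢
  simp only [intervalIntegral.integral_of_le two_pi_pos.le]
  exact hi.integral_prod_right.comp_snd _

lemma etaHat_space_integral {f : ℝ → ℝ → ℂ} (hi : Integrable (Function.uncurry f) μTR) (ξ : ℝ) :
    etaHat (fun v => ∫ x in (0 : ℝ)..(2 * π), f x v) ξ = 2 * π * fHat f 0 ξ := by
  rw [etaHat, fHat_zero, fHat_zero,
    integral_snd_μTR fun v => (∫ x in (0 : ℝ)..(2 * π), f x v) *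
      Complex.exp (-Complex.I * (ξ * v))]
  have h := integrable_mul_exp_neg_I hi ξ
  unfold μTR at h ⊢
  rw [integral_prod_symm _ h]
  simp only [intervalIntegral.integral_of_le two_pi_pos.le, integral_mul_const]
  ring

lemma fHat_zero_add {f h : ℝ → ℝ → ℂ} (hf : Integrable (Function.uncurry f) μTR)
    (hh : Integrable (Function.uncurry h) μTR) (ξ : ℝ) :
    fHat (fun x v => f x v + h x v) 0 ξ = fHat f 0 ξ + fHat h 0 ξ := by
  simp only [fHat_zero, add_mul]
  rw [← mul_add, ← integral_add (integrable_mul_exp_neg_I hf ξ)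
    (integrable_mul_exp_neg_I hh ξ)]

lemma fHat_zero_sub {f h : ℝ → ℝ → ℂ} (hf : Integrable (Function.uncurry f) μTR)
    (hh : Integrable (Function.uncurry h) μTR) (ξ : ℝ) :
    fHat (fun x v => f x v - h x v) 0 ξ = fHat f 0 ξ - fHat h 0 ξ := by
  simp only [fHat_zero, sub_mul]
  rw [← mul_sub, ← integral_sub (integrable_mul_exp_neg_I hf ξ)
    (integrable_mul_exp_neg_I hh ξ)]

lemma fHat_zero_const_mul (c : ℂ) (f : ℝ → ℝ → ℂ) (ξ : ℝ) :
    fHat (fun x v => c * f x v) 0 ξ = c * fHat f 0 ξ := by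
  simp only [fHat_zero, mul_assoc, integral_const_mul]
  ring

lemma jap_pos (t : ℝ) : 0 < jap t := Real.sqrt_pos.2 (by positivity)

lemma jap_pow_le (ξ : ℝ) (n : ℕ) : jap ξ ^ n ≤ 2 ^ n * (1 + |ξ| ^ n) := by
  have h : jap ξ ≤ 2 * max 1 |ξ| := by
    refine Real.sqrt_le_iff.2 ⟨by positivity, ?_⟩
    have h1 := le_max_left 1 |ξ|
    have h2 := le_max_right 1 |ξ|
    nlinarith [sq_abs ξ, abs_nonneg ξ]
  calc jap ξ ^ n ≤ (2 * max 1 |ξ|) ^ n := pow_le_pow_left₀ (jap_pos ξ).le h n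
    _ = 2 ^ n * max 1 |ξ| ^ n := mul_pow _ _ _
    _ ≤ 2 ^ n * (1 + |ξ| ^ n) := by
      gcongr
      rcases le_total 1 |ξ| with h' | h'
      · rw [max_eq_right h']; linarith
      · rw [max_eq_left h', one_pow]; linarith [pow_nonneg (abs_nonneg ξ) n]

lemma integral_wInt_le_HnormSq {m0 : ℝ} {n p q : ℕ} (hpq : p + q ≤ n) (f : ℝ → ℝ → ℂ) :
    ∫ z, wInt m0 p q f z ∂μTR ≤ HnormSq m0 n f := by
  have h0 : ∀ i j, 0 ≤ ∫ z, wInt m0 i j f z ∂μTR := fun i j =>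
    integral_nonneg fun z => by unfold wInt; positivity
  calc ∫ z, wInt m0 p q f z ∂μTR
      ≤ ∑ j ∈ Finset.range (n + 1 - p), ∫ z, wInt m0 p j f z ∂μTR :=
        Finset.single_le_sum (f := fun j => ∫ z, wInt m0 p j f z ∂μTR) (fun j _ => h0 p j)
          (Finset.mem_range.2 (by omega))
    _ ≤ HnormSq m0 n f :=
        Finset.single_le_sum
          (f := fun i => ∑ j ∈ Finset.range (n + 1 - i), ∫ z, wInt m0 i j f z ∂μTR)
          (fun i _ => Finset.sum_nonneg fun j _ => h0 i j) (Finset.mem_range.2 (by omega))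

lemma MemH.continuous {m0 : ℝ} {n : ℕ} {f : ℝ → ℝ → ℂ} (hf : MemH m0 n f) :
    Continuous (Function.uncurry f) := hf.1.continuous

lemma MemH.integrable {m0 : ℝ} (hm0 : 1 / 2 < m0) {n : ℕ} {f : ℝ → ℝ → ℂ} (hf : MemH m0 n f) :
    Integrable (Function.uncurry f) μTR :=
  integrable_of_weighted hm0 hf.continuous (hf.2.2 0 0 n.zero_le)

lemma integrable_wInt_sub {m0 : ℝ} {n m q : ℕ} {f h : ℝ → ℝ → ℂ} (hf : MemH m0 n f)
    (hh : MemH m0 m h) (hqn : q ≤ n) (hqm : q ≤ m) :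
    Integrable (wInt m0 0 q fun x v => f x v - h x v) μTR := by
  have hf' : ContDiff ℝ q (Function.uncurry f) := hf.1.of_le (by exact_mod_cast hqn)
  have hh' : ContDiff ℝ q (Function.uncurry h) := hh.1.of_le (by exact_mod_cast hqm)
  have hc := continuous_iterate_pV (f := fun x v => f x v - h x v) le_rfl (hf'.sub hh')
  refine (((hf.2.2 0 q (by omega)).const_mul 2).add ((hh.2.2 0 q (by omega)).const_mul 2)).mono'
    ?_ (.of_forall fun z => ?_)
  · have hw : Continuous fun z : ℝ × ℝ => (1 + z.2 ^ 2) ^ m0 :=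
      Continuous.rpow_const (by fun_prop) fun z => .inl (by positivity)
    exact (hw.mul (hc.norm.pow 2)).aestronglyMeasurable
  · simp only [wInt, Function.iterate_zero, id_eq, Pi.add_apply]
    rw [Real.norm_of_nonneg (by positivity), iterate_pV_sub le_rfl hf' hh']
    have hsq : ‖(pV^[q] f) z.1 z.2 - (pV^[q] h) z.1 z.2‖ ^ 2 ≤
        2 * ‖(pV^[q] f) z.1 z.2‖ ^ 2 + 2 * ‖(pV^[q] h) z.1 z.2‖ ^ 2 := by
      have := norm_sub_le ((pV^[q] f) z.1 z.2) ((pV^[q] h) z.1 z.2)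
      nlinarith [norm_nonneg ((pV^[q] f) z.1 z.2 - (pV^[q] h) z.1 z.2),
        sq_nonneg (‖(pV^[q] f) z.1 z.2‖ - ‖(pV^[q] h) z.1 z.2‖)]
    calc _ ≤ (1 + z.2 ^ 2) ^ m0 *
          (2 * ‖(pV^[q] f) z.1 z.2‖ ^ 2 + 2 * ‖(pV^[q] h) z.1 z.2‖ ^ 2) := by gcongr
      _ = _ := by ring

lemma jap_pow_mul_norm_fHat_zero_le {m0 : ℝ} (hm0 : 1 / 2 < m0) {f : ℝ → ℝ → ℂ} {n : ℕ}
    (hf : ContDiff ℝ n (Function.uncurry f)) (hw : ∀ q ≤ n, Integrable (wInt m0 0 q f) μTR)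
    {N : ℝ} (hN : 0 < N) (hle : Hnorm m0 n f ≤ N) (ξ : ℝ) :
    jap ξ ^ n * ‖fHat f 0 ξ‖ ≤
      2 ^ n * 2 * ((∫ z : ℝ × ℝ, ((1 + z.2 ^ 2) ^ m0)⁻¹ ∂μTR) + 1) * N := by
  set A := (∫ z : ℝ × ℝ, ((1 + z.2 ^ 2) ^ m0)⁻¹ ∂μTR) + 1
  set J := ∫ z, f z.1 z.2 * Complex.exp (-Complex.I * (ξ * z.2)) ∂μTR with hJ
  have hc : ∀ q ≤ n, Continuous (Function.uncurry (pV^[q] f)) := fun q hq =>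
    continuous_iterate_pV hq hf
  have hi : ∀ q ≤ n, Integrable (Function.uncurry (pV^[q] f)) μTR := fun q hq =>
    integrable_of_weighted hm0 (hc q hq) (hw q hq)
  have hb : ∀ q ≤ n,
      ‖∫ z, (pV^[q] f) z.1 z.2 * Complex.exp (-Complex.I * (ξ * z.2)) ∂μTR‖ ≤ A * N := by
    intro q hq
    refine (norm_integral_le_integral_norm _).trans ?_
    simp only [norm_mul, norm_exp_neg_I_mul, mul_one]
    refine integral_norm_le_of_weighted hm0 (hc q hq) (hw q hq) hN ?_
    exact (integral_wInt_le_HnormSq (p := 0) (by omega) f).trans ((Real.sqrt_le_left hN.le).1 hle)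
  have h0 : ‖J‖ ≤ A * N := hb 0 n.zero_le
  have hn : |ξ| ^ n * ‖J‖ ≤ A * N := by
    have := hb n le_rfl
    rw [integral_iterate_pV_mul_exp hf hi, ← hJ] at this
    simpa [norm_mul, norm_pow] using this
  have hfJ : ‖fHat f 0 ξ‖ ≤ ‖J‖ := by
    rw [fHat_zero, norm_mul]
    refine mul_le_of_le_one_left (norm_nonneg _) ?_
    rw [norm_div, norm_mul, Complex.norm_real, norm_of_nonneg pi_pos.le]
    simp only [norm_one, Complex.norm_ofNat]
    rw [div_le_one two_pi_pos]
    linarith [two_le_pi]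
  calc jap ξ ^ n * ‖fHat f 0 ξ‖ ≤ 2 ^ n * (1 + |ξ| ^ n) * ‖J‖ := by
        gcongr
        exact jap_pow_le ξ n
    _ = 2 ^ n * (‖J‖ + |ξ| ^ n * ‖J‖) := by ring
    _ ≤ 2 ^ n * (A * N + A * N) := by gcongr
    _ = 2 ^ n * 2 * A * N := by ring

/-- **Weak convergence to a modified state.** Under the hypotheses of the main a priori
bound and given the scattering limit `g^∞ ∈ ℋ^{s-4}` with
`‖g(t) - g^∞‖_{ℋʳ} ≤ C₀/⟨t⟩^{s-r-3}` for `1 ≤ r ≤ s-4`, setting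
`η^∞(v) = η(v) + (ε/2π) ∫_𝕋 g^∞(x,v) dx` and `f(t,x,v) = η(v) + ε g(t,x-tv,v)`, for every
integer `1 ≤ r ≤ s-4` there is a constant `C` with
`|f̂₀(t,ξ) - η̂^∞₀(ξ)| ≤ C/(⟨ξ⟩ʳ ⟨t⟩^{s-r-3})` for all `ξ ∈ ℝ`, `t ≥ 0`; in particular
`f(t)` converges weakly to the spatially homogeneous state `η^∞`. -/
theorem weak_convergence (s : ℕ) (hs : 7 ≤ s) (m0 : ℝ) (hm0 : 1 / 2 < m0)
    (η : ℝ → ℂ) (hη : MemH m0 (s + 4) fun _ v => η v) (hP : Penrose m0 η)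
    (R0 R ε : ℝ) (hR0 : 0 < R0) (hR : 0 < R) (hε : 0 < ε)
    (g : ℝ → ℝ → ℝ → ℂ) (hg : SmoothG g) (hgH : ∀ t : ℝ, MemH m0 s (g t))
    (hsol : IsVHMF ε η g) (hQ0 : Qle m0 s g 0 R0)
    (hQ : ∀ T : ℝ, 0 ≤ T → Qle m0 s g T R)
    (ginf : ℝ → ℝ → ℂ) (hginf : MemH m0 (s - 4) ginf) (C0 : ℝ)
    (hscat : ∀ r : ℕ, 1 ≤ r → r ≤ s - 4 → ∀ t : ℝ, 0 ≤ t →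
      Hnorm m0 r (fun x v => g t x v - ginf x v) ≤ C0 / jap t ^ (s - r - 3)) :
    ∀ r : ℕ, 1 ≤ r → r ≤ s - 4 → ∃ C : ℝ, ∀ ξ : ℝ, ∀ t : ℝ, 0 ≤ t →
      ‖fHat (fun x v => η v + (ε : ℂ) * g t (x - t * v) v) 0 ξ -
          etaHat (fun v => η v + ((ε : ℂ) / (2 * (π : ℂ))) *
            ∫ x in (0 : ℝ)..(2 * π), ginf x v) ξ‖ ≤
        C / (jap ξ ^ r * jap t ^ (s - r - 3)) := by
  intro r hr1 hr
  have hgi := hginf.integrable hm0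
  have hηi := hη.integrable hm0
  refine ⟨ε * (2 ^ r * 2 * ((∫ z : ℝ × ℝ, ((1 + z.2 ^ 2) ^ m0)⁻¹ ∂μTR) + 1) * (|C0| + 1)),
    fun ξ t ht => ?_⟩
  have hti := (hgH t).integrable hm0
  have hpi : (π : ℂ) ≠ 0 := by exact_mod_cast pi_ne_zero
  have hdiff : fHat (fun x v => η v + (ε : ℂ) * g t (x - t * v) v) 0 ξ -
      etaHat (fun v => η v + ((ε : ℂ) / (2 * (π : ℂ))) *
        ∫ x in (0 : ℝ)..(2 * π), ginf x v) ξ =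
      ε * fHat (fun x v => g t x v - ginf x v) 0 ξ := by
    have h1 := fHat_zero_add (f := fun _ v => η v)
      (h := fun x v => (ε : ℂ) * g t (x - t * v) v) hηi
      ((integrable_free_transport (hgH t).continuous (hgH t).2.1 hti t).const_mul _) ξ
    have h2 := fHat_zero_add (f := fun _ v => η v)
      (h := fun _ v => ((ε : ℂ) / (2 * (π : ℂ))) * ∫ x in (0 : ℝ)..(2 * π), ginf x v) hηi
      ((integrable_space_integral hgi).const_mul _) ξ
    have h3 := etaHat_space_integral hgi ξ
    unfold etaHat at h3 ⊢
    rw [h1, h2, fHat_zero_const_mul _ (fun x v => g t (x - t * v) v),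
      fHat_zero_const_mul _ (fun _ v => ∫ x in (0 : ℝ)..(2 * π), ginf x v), h3,
      fHat_zero_free_transport (hgH t).continuous (hgH t).2.1 hti, fHat_zero_sub hti hgi]
    field_simp
    ring
  have hjt : 0 < jap t ^ (s - r - 3) := pow_pos (jap_pos t) _
  have hjξ : 0 < jap ξ ^ r := pow_pos (jap_pos ξ) _
  have hbound := jap_pow_mul_norm_fHat_zero_le hm0 (f := fun x v => g t x v - ginf x v) (n := r)
    (((hgH t).1.of_le (by exact_mod_cast (by omega : r ≤ s))).sub
      (hginf.1.of_le (by exact_mod_cast hr)))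
    (fun q hq => integrable_wInt_sub (hgH t) hginf (by omega) (by omega))
    (N := (|C0| + 1) / jap t ^ (s - r - 3)) (by positivity)
    ((hscat r hr1 hr t ht).trans (by gcongr; linarith [le_abs_self C0])) ξ
  rw [hdiff, norm_mul, Complex.norm_real, norm_of_nonneg hε.le, le_div_iff₀ (by positivity)]
  rw [mul_div_assoc', le_div_iff₀ hjt] at hbound
  calc _ = ε * (jap ξ ^ r * ‖fHat (fun x v => g t x v - ginf x v) 0 ξ‖ *
        jap t ^ (s - r - 3)) := by ring
    _ ≤ _ := by gcongr
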